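/- (Active minimax lower bound, k = 1.) Fix c ∈ (0, 1/4]. There exist constants κ₀ > 0 and κ₁ > 0, depending only on c, such that for every integer n ≥ 1, every σ with e^{−κ₀ n} ≤ σ ≤ 1/2, every active strategy (S₁, …, S_n) with budget n, and every measurable estimator t̂ : ([−1,1] × {0,1})^n → ℝ, one has sup_{t ∈ [−1/2, 1/2]} E_{P^{F_t}_n} |t̂ − t| ≥ κ₁ σ / √n. -/

import Mathlib

open MeasureTheory Real
open scoped ENNReal

/-- Uniform-noise convolution: `(g ⋆ U_σ)(w) = (1/(2σ)) ∫_{w-σ}^{w+σ} g(x) dx`. -/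
noncomputable def unifConv (σ : ℝ) (g : ℝ → ℝ) (w : ℝ) : ℝ :=
  (1 / (2 * σ)) * ∫ x in (w - σ)..(w + σ), g x

/-- Step regression function with threshold `t` and jump size `c`. -/
noncomputable def stepFn (c t : ℝ) (x : ℝ) : ℝ :=
  if x < t then 1 / 2 - c else 1 / 2 + c

/-- The Bernoulli measure with parameter `p` on `Bool`. -/
noncomputable def bern (p : ℝ) : Measure Bool :=
  ENNReal.ofReal p • Measure.dirac true + ENNReal.ofReal (1 - p) • Measure.dirac false

/-- The law `P^F_n` of the query–label sequence `(W₁,Y₁,…,W_n,Y_n)` induced by an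
active strategy `S` and regression function `F`: `W_i = S_i(W₁,Y₁,…,W_{i-1},Y_{i-1})`
and, conditionally on the history, `Y_i` is `Bernoulli(F(W_i))`. -/
noncomputable def activeLaw (F : ℝ → ℝ) :
    (n : ℕ) → ((i : Fin n) → (Fin i → ℝ × Bool) → ℝ) → Measure (Fin n → ℝ × Bool)
  | 0, _ => Measure.dirac (fun i => i.elim0)
  | n + 1, S =>
    (activeLaw F n (fun i h => S i.castSucc h)).bind
      (fun hist =>
        (bern (F (S (Fin.last n) hist))).map
          (fun y => Fin.snoc hist (S (Fin.last n) hist, y)))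

lemma stepFn_monotone {c : ℝ} (hc : 0 ≤ c) (t : ℝ) : Monotone (stepFn c t) := by
  intro x y hxy
  unfold stepFn
  split_ifs <;> linarith

lemma intervalIntegrable_stepFn {c : ℝ} (hc : 0 ≤ c) (t a b : ℝ) :
    IntervalIntegrable (stepFn c t) volume a b :=
  (stepFn_monotone hc t).intervalIntegrable

lemma unifConv_stepFn_mem_Icc {c σ : ℝ} (hc : 0 ≤ c) (hσ : 0 < σ) (t w : ℝ) :
    unifConv σ (stepFn c t) w ∈ Set.Icc (1 / 2 - c) (1 / 2 + c) := by
  have hle : w - σ ≤ w + σ := by linarith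
  have hI := intervalIntegrable_stepFn hc t (w - σ) (w + σ)
  have hlo := intervalIntegral.integral_mono (f := fun _ => 1 / 2 - c) hle
    intervalIntegrable_const hI
    (fun x => by simp only [stepFn]; split_ifs <;> linarith)
  have hhi := intervalIntegral.integral_mono (g := fun _ => 1 / 2 + c) hle hI
    intervalIntegrable_const
    (fun x => by simp only [stepFn]; split_ifs <;> linarith)
  rw [intervalIntegral.integral_const, smul_eq_mul] at hlo hhi
  unfold unifConv
  rw [one_div_mul_eq_div]
  constructor
  · rw [le_div_iff₀ (by positivity)]; linarith
  · rw [div_le_iff₀ (by positivity)]; linarith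

lemma measurable_unifConv_stepFn {c σ : ℝ} (hc : 0 ≤ c) (hσ : 0 < σ) (t : ℝ) :
    Measurable (unifConv σ (stepFn c t)) := by
  refine Monotone.measurable fun v w hvw => ?_
  have hshift : ∀ u : ℝ, ∫ x in (u - σ)..(u + σ), stepFn c t x
      = ∫ x in (-σ)..σ, stepFn c t (x + u) := fun u => by
    rw [intervalIntegral.integral_comp_add_right]
    congr 1 <;> ring
  unfold unifConv
  rw [hshift, hshift]
  refine mul_le_mul_of_nonneg_left ?_ (by positivity)
  have hmono : ∀ u, Monotone fun x => stepFn c t (x + u) := fun u x y hxy =>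
    stepFn_monotone hc t (by linarith)
  exact intervalIntegral.integral_mono (by linarith) (hmono v).intervalIntegrable
    (hmono w).intervalIntegrable fun x => stepFn_monotone hc t (by linarith)

/-- The noise-smoothed step is Lipschitz in its threshold, with constant `c / σ`. -/
lemma abs_unifConv_stepFn_sub_le {c σ s t : ℝ} (hc : 0 ≤ c) (hσ : 0 < σ) (hst : s ≤ t)
    (w : ℝ) :
    |unifConv σ (stepFn c t) w - unifConv σ (stepFn c s) w| ≤ c * (t - s) / σ := by
  have hle : w - σ ≤ w + σ := by linarith
  have hdiff : ∀ x, stepFn c s x - stepFn c t x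
      = (Set.Ico s t).indicator (fun _ => 2 * c) x := fun x => by
    simp only [stepFn, Set.indicator, Set.mem_Ico]
    split_ifs <;> grind
  have hint : ∫ x in (w - σ)..(w + σ), (Set.Ico s t).indicator (fun _ => 2 * c) x
      = (∫ x in (w - σ)..(w + σ), stepFn c s x)
        - ∫ x in (w - σ)..(w + σ), stepFn c t x := by
    rw [← intervalIntegral.integral_sub (intervalIntegrable_stepFn hc _ _ _)
      (intervalIntegrable_stepFn hc _ _ _)]
    simp only [hdiff]
  have hnonneg : ∀ x, 0 ≤ (Set.Ico s t).indicator (fun _ : ℝ => 2 * c) x := fun x =>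
    Set.indicator_nonneg (fun _ _ => by positivity) x
  have h0 := intervalIntegral.integral_nonneg (μ := volume) hle fun x _ => hnonneg x
  have hIoc : ∫ x in (w - σ)..(w + σ), (Set.Ico s t).indicator (fun _ => 2 * c) x
      ≤ 2 * c * (t - s) := by
    rw [intervalIntegral.integral_of_le hle]
    calc _ ≤ ∫ x, (Set.Ico s t).indicator (fun _ => 2 * c) x :=
          setIntegral_le_integral
            ((integrable_indicator_iff measurableSet_Ico).2 (integrableOn_const (by simp)))
            (Filter.Eventually.of_forall hnonneg)
      _ = 2 * c * (t - s) := by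
          rw [integral_indicator measurableSet_Ico, setIntegral_const]
          simp [hst, mul_comm]
  unfold unifConv
  rw [← mul_sub, abs_mul, abs_of_pos (by positivity), abs_sub_comm, abs_of_nonneg
    (by linarith), ← hint, one_div_mul_eq_div, div_le_div_iff₀ (by positivity) hσ]
  nlinarith

lemma lintegral_map_bern {α : Type*} [MeasurableSpace α] (p : ℝ) (g : Bool → α)
    {f : α → ℝ≥0∞} (hf : Measurable f) :
    ∫⁻ x, f x ∂((bern p).map g)
      = ENNReal.ofReal p * f (g true) + ENNReal.ofReal (1 - p) * f (g false) := by
  rw [lintegral_map hf (measurable_of_countable g), bern, lintegral_add_measure,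
    lintegral_smul_measure, lintegral_smul_measure, lintegral_dirac, lintegral_dirac]
  rfl

lemma measurable_snoc_pair {n : ℕ} {w : (Fin n → ℝ × Bool) → ℝ} (hw : Measurable w)
    (y : Bool) :
    Measurable fun h : Fin n → ℝ × Bool =>
      (Fin.snoc h (w h, y) : Fin (n + 1) → ℝ × Bool) := by
  refine measurable_pi_lambda _ fun i => ?_
  induction i using Fin.lastCases with
  | last => simpa using hw.prodMk measurable_const
  | cast i => simpa using measurable_pi_apply i

lemma measurable_bern_map_snoc {n : ℕ} {F : ℝ → ℝ} (hF : Measurable F)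
    {w : (Fin n → ℝ × Bool) → ℝ} (hw : Measurable w) :
    Measurable fun h : Fin n → ℝ × Bool => (bern (F (w h))).map
      fun y => (Fin.snoc h (w h, y) : Fin (n + 1) → ℝ × Bool) := by
  refine Measure.measurable_of_measurable_coe _ fun s hs => ?_
  have hind : Measurable (s.indicator (1 : (Fin (n + 1) → ℝ × Bool) → ℝ≥0∞)) :=
    measurable_one.indicator hs
  simp_rw [← lintegral_indicator_one hs, lintegral_map_bern _ _ hind]
  have h1 := hind.comp (measurable_snoc_pair hw true)
  have h2 := hind.comp (measurable_snoc_pair hw false)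
  exact ((hF.comp hw).ennreal_ofReal.mul h1).add
    (((hF.comp hw).const_sub 1).ennreal_ofReal.mul h2)

lemma lintegral_activeLaw_succ {F : ℝ → ℝ} (hF : Measurable F) {n : ℕ}
    (S : (i : Fin (n + 1)) → (Fin i → ℝ × Bool) → ℝ) (hS : ∀ i, Measurable (S i))
    {f : (Fin (n + 1) → ℝ × Bool) → ℝ≥0∞} (hf : Measurable f) :
    ∫⁻ x, f x ∂(activeLaw F (n + 1) S)
      = ∫⁻ h, (ENNReal.ofReal (F (S (Fin.last n) h)) *
            f (Fin.snoc h (S (Fin.last n) h, true)) +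
          ENNReal.ofReal (1 - F (S (Fin.last n) h)) *
            f (Fin.snoc h (S (Fin.last n) h, false)))
        ∂(activeLaw F n fun i h => S i.castSucc h) := by
  have hm := measurable_bern_map_snoc hF (hS (Fin.last n))
  refine (Measure.lintegral_bind hm.aemeasurable hf.aemeasurable).trans ?_
  exact lintegral_congr fun h => lintegral_map_bern _ _ hf

lemma isProbabilityMeasure_activeLaw {F : ℝ → ℝ} (hF : Measurable F)
    (hF01 : ∀ w, F w ∈ Set.Icc (0 : ℝ) 1) {n : ℕ}
    (S : (i : Fin n) → (Fin i → ℝ × Bool) → ℝ) (hS : ∀ i, Measurable (S i)) :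
    IsProbabilityMeasure (activeLaw F n S) := by
  induction n with
  | zero => exact Measure.dirac.isProbabilityMeasure
  | succ n ih =>
    have := ih (fun i h => S i.castSucc h) fun i => hS i.castSucc
    constructor
    rw [← lintegral_one, lintegral_activeLaw_succ hF S hS measurable_const]
    simp_rw [mul_one, ← ENNReal.ofReal_add (hF01 _).1 (sub_nonneg.2 (hF01 _).2)]
    simp

/-- Cauchy–Schwarz for two Bernoulli laws whose chi-square divergence is at most `κ`. -/
lemma bernoulli_mean_sq_le {p q κ a b : ℝ} (hp : 0 < p) (hp1 : p < 1)
    (h : (q - p) ^ 2 ≤ κ * (p * (1 - p))) :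
    (q * a + (1 - q) * b) ^ 2 ≤ (1 + κ) * (p * a ^ 2 + (1 - p) * b ^ 2) := by
  have hp' : 0 < 1 - p := by linarith
  have hpp : 0 < p * (1 - p) := by positivity
  have hM : 0 ≤ p * a ^ 2 + (1 - p) * b ^ 2 := by positivity
  refine le_of_mul_le_mul_left ?_ hpp
  calc p * (1 - p) * (q * a + (1 - q) * b) ^ 2
      ≤ (p * (1 - p) + (q - p) ^ 2) * (p * a ^ 2 + (1 - p) * b ^ 2) := by
        have : (p * (1 - p) + (q - p) ^ 2) * (p * a ^ 2 + (1 - p) * b ^ 2)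
            - p * (1 - p) * (q * a + (1 - q) * b) ^ 2
            = ((1 - q) * p * a - q * (1 - p) * b) ^ 2 := by ring
        nlinarith [sq_nonneg ((1 - q) * p * a - q * (1 - p) * b)]
    _ ≤ (p * (1 - p) + κ * (p * (1 - p))) * (p * a ^ 2 + (1 - p) * b ^ 2) := by gcongr
    _ = p * (1 - p) * ((1 + κ) * (p * a ^ 2 + (1 - p) * b ^ 2)) := by ring

lemma bernoulli_lintegral_sq_le {p q κ : ℝ} (hp : 0 < p) (hp1 : p < 1) (hq : 0 ≤ q)
    (hq1 : q ≤ 1) (hκ : 0 ≤ κ) (h : (q - p) ^ 2 ≤ κ * (p * (1 - p))) (a b : ℝ≥0∞) :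
    (ENNReal.ofReal q * a + ENNReal.ofReal (1 - q) * b) ^ 2
      ≤ ENNReal.ofReal (1 + κ) *
        (ENNReal.ofReal p * a ^ 2 + ENNReal.ofReal (1 - p) * b ^ 2) := by
  have hK : ENNReal.ofReal (1 + κ) ≠ 0 := by simp; linarith
  have hp0 : ENNReal.ofReal p ≠ 0 := by simpa
  have hp0' : ENNReal.ofReal (1 - p) ≠ 0 := by simpa
  rcases eq_or_ne a ∞ with rfl | ha
  · simp [ENNReal.mul_top, hK, hp0]
  rcases eq_or_ne b ∞ with rfl | hb
  · simp [ENNReal.mul_top, hK, hp0']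
  rw [← ENNReal.ofReal_toReal ha, ← ENNReal.ofReal_toReal hb]
  have ha0 := a.toReal_nonneg
  have hb0 := b.toReal_nonneg
  have hq' : 0 ≤ 1 - q := by linarith
  have hp' : 0 ≤ 1 - p := by linarith
  rw [← ENNReal.ofReal_pow ha0, ← ENNReal.ofReal_pow hb0, ← ENNReal.ofReal_mul hq,
    ← ENNReal.ofReal_mul hq', ← ENNReal.ofReal_mul hp.le, ← ENNReal.ofReal_mul hp',
    ← ENNReal.ofReal_add (by positivity) (by positivity),
    ← ENNReal.ofReal_add (by positivity) (by positivity),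
    ← ENNReal.ofReal_pow (by positivity), ← ENNReal.ofReal_mul (by positivity)]
  exact ENNReal.ofReal_le_ofReal (bernoulli_mean_sq_le hp hp1 h)

/-- Tensorized chi-square bound: if the one-step divergence is at most `κ` at every query
point, the `n`-step law under `G` is controlled by the one under `F` up to `(1 + κ) ^ n`. -/
lemma sq_lintegral_activeLaw_le {F G : ℝ → ℝ} (hF : Measurable F) (hG : Measurable G)
    (hF01 : ∀ w, F w ∈ Set.Ioo (0 : ℝ) 1) (hG01 : ∀ w, G w ∈ Set.Icc (0 : ℝ) 1)
    {κ : ℝ} (hκ : 0 ≤ κ) (hFG : ∀ w, (G w - F w) ^ 2 ≤ κ * (F w * (1 - F w)))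
    {n : ℕ} (S : (i : Fin n) → (Fin i → ℝ × Bool) → ℝ) (hS : ∀ i, Measurable (S i))
    {f : (Fin n → ℝ × Bool) → ℝ≥0∞} (hf : Measurable f) :
    (∫⁻ x, f x ∂(activeLaw G n S)) ^ 2
      ≤ ENNReal.ofReal (1 + κ) ^ n * ∫⁻ x, f x ^ 2 ∂(activeLaw F n S) := by
  induction n with
  | zero =>
    simp only [activeLaw]
    rw [lintegral_dirac' _ hf, lintegral_dirac' _ (hf.pow_const 2)]
    simp
  | succ n ih =>
    have hw : Measurable (S (Fin.last n)) := hS (Fin.last n)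
    have hstep : ∀ y, Measurable fun h : Fin n → ℝ × Bool =>
        f (Fin.snoc h (S (Fin.last n) h, y)) := fun y =>
      hf.comp (measurable_snoc_pair hw y)
    have hcond : Measurable fun h : Fin n → ℝ × Bool =>
        ENNReal.ofReal (G (S (Fin.last n) h)) * f (Fin.snoc h (S (Fin.last n) h, true)) +
          ENNReal.ofReal (1 - G (S (Fin.last n) h)) *
            f (Fin.snoc h (S (Fin.last n) h, false)) :=
      ((hG.comp hw).ennreal_ofReal.mul (hstep true)).add
        (((hG.comp hw).const_sub 1).ennreal_ofReal.mul (hstep false))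
    rw [lintegral_activeLaw_succ hG S hS hf,
      lintegral_activeLaw_succ hF S hS (hf.pow_const 2)]
    refine (ih (fun i h => S i.castSucc h) (fun i => hS i.castSucc) hcond).trans ?_
    rw [pow_succ, mul_assoc, ← lintegral_const_mul' _ _ ENNReal.ofReal_ne_top]
    gcongr with h
    exact bernoulli_lintegral_sq_le (hF01 _).1 (hF01 _).2 (hG01 _).1 (hG01 _).2 hκ (hFG _) _ _

/-- Le Cam's two-point bound, with closeness of the laws measured on events. -/
lemma two_point_lower_bound {Ω : Type*} [MeasurableSpace Ω] {P Q : Measure Ω}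
    [IsProbabilityMeasure Q] (hPQ : ∀ A, MeasurableSet A → Q A ^ 2 ≤ 2 * P A)
    {T : Ω → ℝ} (hT : Measurable T) {s t : ℝ} (hst : s ≤ t) :
    ENNReal.ofReal ((t - s) / 16) ≤
      max (∫⁻ x, ENNReal.ofReal |T x - s| ∂P) (∫⁻ x, ENNReal.ofReal |T x - t| ∂Q) := by
  set A : Set Ω := {x | (s + t) / 2 ≤ T x}
  have hA : MeasurableSet A := measurableSet_le measurable_const hT
  have hmarkov : ∀ (μ : Measure Ω) (u : ℝ) (B : Set Ω), MeasurableSet B →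
      (∀ x ∈ B, (t - s) / 2 ≤ |T x - u|) →
      ENNReal.ofReal ((t - s) / 2) * μ B ≤ ∫⁻ x, ENNReal.ofReal |T x - u| ∂μ := by
    intro μ u B hB h
    rw [← lintegral_indicator_const hB]
    exact lintegral_mono (Set.indicator_le fun x hx => ENNReal.ofReal_le_ofReal (h x hx))
  have hP := hmarkov P s A hA fun x (hx : (s + t) / 2 ≤ T x) =>
    le_abs.2 (Or.inl (by linarith))
  have hQ := hmarkov Q t Aᶜ hA.compl fun x hx =>
    le_abs.2 (Or.inr (by linarith [not_le.1 (show ¬ (s + t) / 2 ≤ T x from hx)]))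
  have hsplit : ENNReal.ofReal ((t - s) / 16)
      = ENNReal.ofReal ((t - s) / 2) * ENNReal.ofReal (1 / 8) := by
    rw [← ENNReal.ofReal_mul (by linarith)]
    congr 1
    ring
  rw [hsplit, le_max_iff]
  by_cases h8 : ENNReal.ofReal (1 / 8) ≤ P A
  · left
    exact (by gcongr : _ ≤ ENNReal.ofReal ((t - s) / 2) * P A).trans hP
  · right
    refine le_trans (mul_le_mul_right ?_ _) hQ
    rw [← ofReal_measureReal, ENNReal.ofReal_le_ofReal_iff measureReal_nonneg,
      probReal_compl_eq_one_sub hA]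
    have hsq : Q A ^ 2 ≤ ENNReal.ofReal (1 / 4) := by
      refine (hPQ A hA).trans ((by gcongr; exact (not_le.1 h8).le :
        2 * P A ≤ 2 * ENNReal.ofReal (1 / 8)).trans ?_)
      rw [← ENNReal.ofReal_ofNat, ← ENNReal.ofReal_mul (by norm_num)]
      exact ENNReal.ofReal_le_ofReal (by norm_num)
    rw [← ofReal_measureReal, ← ENNReal.ofReal_pow measureReal_nonneg,
      ENNReal.ofReal_le_ofReal_iff (by norm_num)] at hsq
    nlinarith [measureReal_nonneg (μ := Q) (s := A)]

lemma one_add_one_third_div_pow_le_two {n : ℕ} (hn : 1 ≤ n) :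
    (1 + 1 / (3 * (n : ℝ))) ^ n ≤ 2 := by
  have hn0 : (0 : ℝ) < n := by exact_mod_cast hn
  have h3 : Real.exp (1 / 3) ≤ 2 := by
    have h := Real.exp_one_lt_d9
    have h' : Real.exp (1 / 3) ^ 3 = Real.exp 1 := by
      rw [← Real.exp_nat_mul]
      norm_num
    refine le_of_pow_le_pow_left₀ three_ne_zero (by norm_num) ?_
    rw [h']
    linarith
  calc (1 + 1 / (3 * (n : ℝ))) ^ n ≤ Real.exp (1 / (3 * (n : ℝ))) ^ n := by
        gcongr
        linarith [Real.add_one_le_exp (1 / (3 * (n : ℝ)))]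
    _ = Real.exp (1 / 3) := by
        rw [← Real.exp_nat_mul]
        congr 1
        field_simp
    _ ≤ 2 := h3

/-- Active minimax lower bound, `k = 1`: for `e^{-κ₀ n} ≤ σ ≤ 1/2`, every active
strategy with budget `n` and every estimator have worst-case point error at least
`κ₁ σ/√n` over thresholds `t ∈ [-1/2, 1/2]`. -/
theorem active_lower_bound_k_one (c : ℝ) (hc : c ∈ Set.Ioc (0 : ℝ) (1 / 4)) :
    ∃ κ₀ κ₁ : ℝ, 0 < κ₀ ∧ 0 < κ₁ ∧
      ∀ n : ℕ, 1 ≤ n → ∀ σ : ℝ, Real.exp (-κ₀ * n) ≤ σ → σ ≤ 1 / 2 →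
        ∀ S : (i : Fin n) → (Fin i → ℝ × Bool) → ℝ, (∀ i, Measurable (S i)) →
          (∀ (i : Fin n) (h : Fin i → ℝ × Bool), S i h ∈ Set.Icc (-1 : ℝ) 1) →
          ∀ that : (Fin n → ℝ × Bool) → ℝ, Measurable that →
            ENNReal.ofReal (κ₁ * σ / Real.sqrt n) ≤
              ⨆ t ∈ Set.Icc (-(1 : ℝ) / 2) (1 / 2),
                ∫⁻ x, ENNReal.ofReal |that x - t|
                  ∂(activeLaw (unifConv σ (stepFn c t)) n S) := by
  obtain ⟨hc0, hc4⟩ := hc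
  refine ⟨1, 1 / 16, one_pos, by norm_num, fun n hn σ hσ hσ2 S hS _ that hthat => ?_⟩
  have hσ0 : 0 < σ := (Real.exp_pos _).trans_le hσ
  have hn1 : (1 : ℝ) ≤ n := by exact_mod_cast hn
  have hsqrt : 1 ≤ √(n : ℝ) := Real.one_le_sqrt.2 hn1
  set δ : ℝ := σ / √n with hδ
  have hδ0 : 0 < δ := by positivity
  have hδ2 : δ ≤ 1 / 2 := (div_le_self hσ0.le hsqrt).trans hσ2
  set F : ℝ → ℝ → ℝ := fun t => unifConv σ (stepFn c t)
  have hF (t w : ℝ) : F t w ∈ Set.Icc (1 / 4 : ℝ) (3 / 4) := by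
    have := unifConv_stepFn_mem_Icc hc0.le hσ0 t w
    exact ⟨by linarith [this.1], by linarith [this.2]⟩
  have hmeas (t : ℝ) : Measurable (F t) := measurable_unifConv_stepFn hc0.le hσ0 t
  have h01 (t w : ℝ) : F t w ∈ Set.Icc (0 : ℝ) 1 :=
    ⟨by linarith [(hF t w).1], by linarith [(hF t w).2]⟩
  have hchi (w : ℝ) :
      (F δ w - F 0 w) ^ 2 ≤ 1 / (3 * (n : ℝ)) * (F 0 w * (1 - F 0 w)) := by
    have hlip : |F δ w - F 0 w| ≤ 1 / 4 * (1 / √n) := by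
      refine (abs_unifConv_stepFn_sub_le hc0.le hσ0 hδ0.le w).trans ?_
      have : c * (δ - 0) / σ = c * (1 / √n) := by rw [hδ]; field_simp; ring
      rw [this]
      gcongr
    have hvar : 3 / 16 ≤ F 0 w * (1 - F 0 w) := by nlinarith [(hF 0 w).1, (hF 0 w).2]
    calc (F δ w - F 0 w) ^ 2 = |F δ w - F 0 w| ^ 2 := (sq_abs _).symm
      _ ≤ (1 / 4 * (1 / √n)) ^ 2 := by gcongr
      _ = 1 / (3 * (n : ℝ)) * (3 / 16) := by
          rw [mul_pow, div_pow, div_pow, Real.sq_sqrt (by positivity)]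
          field_simp
          norm_num
      _ ≤ _ := by gcongr
  have := isProbabilityMeasure_activeLaw (hmeas δ) (h01 δ) S hS
  have hPQ (A : Set (Fin n → ℝ × Bool)) (hA : MeasurableSet A) :
      activeLaw (F δ) n S A ^ 2 ≤ 2 * activeLaw (F 0) n S A := by
    have h := sq_lintegral_activeLaw_le (hmeas 0) (hmeas δ)
      (fun w => ⟨by linarith [(hF 0 w).1], by linarith [(hF 0 w).2]⟩) (h01 δ)
      (by positivity) hchi S hS (measurable_one.indicator hA)
    have hsq (x) : A.indicator (1 : (Fin n → ℝ × Bool) → ℝ≥0∞) x ^ 2 = A.indicator 1 x := by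
      by_cases hx : x ∈ A <;> simp [hx]
    simp_rw [hsq, lintegral_indicator_one hA] at h
    refine h.trans ?_
    gcongr
    rw [← ENNReal.ofReal_pow (by positivity), ← ENNReal.ofReal_ofNat]
    exact ENNReal.ofReal_le_ofReal (one_add_one_third_div_pow_le_two hn)
  have hrate : 1 / 16 * σ / √n = (δ - 0) / 16 := by rw [hδ]; ring
  rw [hrate]
  refine (two_point_lower_bound hPQ hthat hδ0.le).trans (max_le ?_ ?_)
  · exact le_iSup₂_of_le (0 : ℝ) ⟨by norm_num, by norm_num⟩ le_rfl
  · exact le_iSup₂_of_le δ ⟨by linarith, hδ2⟩ le_rfl
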